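/- Suppose μ_1, μ_2 ∈ M(ℝⁿ) satisfy s(α) := ∫_{ℝⁿ} x^α dμ_1(x) = ∫_{ℝⁿ} x^α dμ_2(x) for all α ∈ ℕⁿ, and that ∑_{m=1}^∞ s(2m e_j)^{−1/(2m)} = ∞ for each j = 1, …, n, where e_j is the j-th canonical basis vector of ℝⁿ. Then μ_1 = μ_2. -/

import Mathlib

open MeasureTheory

/-- `μ ∈ M(ℝⁿ)`: a positive Borel measure on `ℝⁿ` all of whose absolute moments
`∫ ‖x‖^d dμ` are finite. -/
def HasAllMoments {n : ℕ} (μ : Measure (EuclideanSpace ℝ (Fin n))) : Prop :=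
  ∀ d : ℝ, 0 ≤ d → Integrable (fun x : EuclideanSpace ℝ (Fin n) => ‖x‖ ^ d) μ

open Real in
/-- Carleman's inequality, as a summability statement. -/
theorem Summable.geom_mean {a : ℕ → ℝ} (ha : ∀ k, 0 ≤ a k) (hs : Summable a) :
    Summable fun n : ℕ => (∏ k ∈ Finset.range (n + 1), a k) ^ ((1 : ℝ) / (n + 1)) := by
  set S : ℕ → ℝ := fun n => ∑ k ∈ Finset.range (n + 1), ((k : ℝ) + 1) * a k with hS
  have hS0 (n) : 0 ≤ S n := Finset.sum_nonneg fun k _ => mul_nonneg (by positivity) (ha k)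
  have hprod (n) : 0 ≤ ∏ k ∈ Finset.range n, a k := Finset.prod_nonneg fun k _ => ha k
  have amgm (n : ℕ) : (∏ k ∈ Finset.range (n + 1), a k) ^ ((1 : ℝ) / (n + 1)) ≤
      2 * exp 1 * (S n / ((n + 1) * (n + 2))) := by
    have h1 := Real.geom_mean_le_arith_mean (Finset.range (n + 1)) (fun _ => 1)
      (fun k => ((k : ℝ) + 1) * a k) (by simp) (by simp; positivity)
      (fun k _ => mul_nonneg (by positivity) (ha k))
    simp only [rpow_one, Finset.sum_const, Finset.card_range, nsmul_eq_mul, mul_one,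
      one_mul, Nat.cast_add, Nat.cast_one, Finset.prod_mul_distrib] at h1
    have hfac : ∏ k ∈ Finset.range (n + 1), ((k : ℝ) + 1) = ((n + 1).factorial : ℝ) := by
      rw [← Finset.prod_range_add_one_eq_factorial]; push_cast; rfl
    rw [hfac, mul_rpow (by positivity) (hprod _), ← one_div] at h1
    have h2 : ((n : ℝ) + 1) / exp 1 ≤ ((n + 1).factorial : ℝ) ^ ((1 : ℝ) / (n + 1)) := by
      have h3 := Real.pow_div_factorial_le_exp (x := (n : ℝ) + 1) (by positivity) (n + 1)
      have h4 : (((n : ℝ) + 1) / exp 1) ^ (n + 1) ≤ ((n + 1).factorial : ℝ) := by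
        rw [div_pow, ← exp_nat_mul, div_le_iff₀ (by positivity)]
        rw [div_le_iff₀ (by positivity)] at h3
        push_cast
        rw [mul_one]; linarith
      calc ((n : ℝ) + 1) / exp 1
          = ((((n : ℝ) + 1) / exp 1) ^ (n + 1)) ^ ((1 : ℝ) / (n + 1)) := by
            rw [← rpow_natCast, ← rpow_mul (by positivity)]
            push_cast
            rw [mul_one_div_cancel (by positivity), rpow_one]
        _ ≤ _ := rpow_le_rpow (by positivity) h4 (by positivity)
    set g := (∏ k ∈ Finset.range (n + 1), a k) ^ ((1 : ℝ) / (n + 1))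
    have hg : 0 ≤ g := rpow_nonneg (hprod _) _
    have h5 : ((n : ℝ) + 1) / exp 1 * g ≤ S n / (n + 1) :=
      (mul_le_mul_of_nonneg_right h2 hg).trans h1
    have h6 : g ≤ exp 1 * (S n / ((n + 1) * (n + 1))) := by
      have he := exp_pos 1
      have : g = exp 1 / (n + 1) * (((n : ℝ) + 1) / exp 1 * g) := by field_simp
      rw [this]
      calc _ ≤ exp 1 / (n + 1) * (S n / (n + 1)) := by gcongr
        _ = _ := by field_simp
    refine h6.trans ?_
    rw [mul_comm 2 (exp 1), mul_assoc]
    gcongr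
    rw [← mul_div_assoc, div_le_div_iff₀ (by positivity) (by positivity)]
    nlinarith [mul_nonneg (hS0 n) (show (0 : ℝ) ≤ (n + 1) * n by positivity)]
  have tele (N : ℕ) : ∑ n ∈ Finset.range (N + 1), S n / (((n : ℝ) + 1) * (n + 2)) =
      ∑ k ∈ Finset.range (N + 1), a k - S N / (N + 2) := by
    induction N with
    | zero => simp [hS]; ring
    | succ N ih =>
      rw [Finset.sum_range_succ, ih, Finset.sum_range_succ _ (N + 1)]
      have : S (N + 1) = S N + ((N : ℝ) + 2) * a (N + 1) := by
        simp only [hS]; rw [Finset.sum_range_succ _ (N + 1)]; push_cast; ring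
      rw [this]; push_cast; field_simp; ring
  have hsum : Summable fun n : ℕ => S n / (((n : ℝ) + 1) * (n + 2)) := by
    refine summable_of_sum_range_le (c := ∑' k, a k)
      (fun n => div_nonneg (hS0 n) (by positivity)) fun N => ?_
    refine (Finset.sum_le_sum_of_subset_of_nonneg (Finset.range_mono N.le_succ)
      fun n _ _ => div_nonneg (hS0 n) (by positivity)).trans ?_
    rw [tele]
    have := hs.sum_le_tsum (Finset.range (N + 1)) fun k _ => ha k
    have := div_nonneg (hS0 N) (show (0 : ℝ) ≤ N + 2 by positivity)
    linarith
  exact Summable.of_nonneg_of_le (fun n => rpow_nonneg (hprod _) _) amgm (hsum.mul_left _)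

theorem not_summable_ratio_of_carleman {M : ℕ → ℝ} (hM : ∀ m, 0 < M m)
    (hdiv : ¬ Summable fun m : ℕ => M (m + 1) ^ (-(1 : ℝ) / (m + 1))) :
    ¬ Summable fun m => M m / M (m + 1) := by
  intro hs
  have h := (hs.geom_mean fun k => (div_pos (hM _) (hM _)).le).mul_left (max 1 (M 0)⁻¹)
  refine hdiv (Summable.of_nonneg_of_le (fun m => Real.rpow_nonneg (hM _).le _) (fun m => ?_) h)
  have hprod : ∏ k ∈ Finset.range (m + 1), M k / M (k + 1) = M 0 / M (m + 1) := by
    induction m with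
    | zero => simp
    | succ m ih => rw [Finset.prod_range_succ, ih, div_mul_div_cancel₀ (hM _).ne']
  rw [hprod, Real.div_rpow (hM _).le (hM _).le, neg_div, Real.rpow_neg (hM _).le, ← one_div,
    ← mul_div_assoc]
  gcongr
  · exact Real.rpow_nonneg (hM _).le _
  have hexp0 : (0 : ℝ) ≤ 1 / (m + 1) := by positivity
  have hexp1 : (1 : ℝ) / (m + 1) ≤ 1 := by
    rw [div_le_one (by positivity)]; linarith [(Nat.cast_nonneg m : (0 : ℝ) ≤ m)]
  rcases le_total 1 (M 0) with h1 | h1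
  · have h2 := Real.one_le_rpow h1 hexp0
    nlinarith [le_max_left 1 (M 0)⁻¹]
  · have h2 := Real.rpow_le_rpow_of_exponent_ge (hM 0) h1 hexp1
    rw [Real.rpow_one] at h2
    calc 1 = (M 0)⁻¹ * M 0 := (inv_mul_cancel₀ (hM 0).ne').symm
      _ ≤ _ := mul_le_mul (le_max_right _ _) h2 (hM 0).le (by positivity)

section Bang

variable {E : Type*} [NormedAddCommGroup E] [NormedSpace ℝ E] {G : ℕ → ℝ → E} {M : ℕ → ℝ}

theorem mul_le_mul_of_logConvex (hM : ∀ m, 0 < M m)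
    (hlc : ∀ m, M (m + 1) ^ 2 ≤ M m * M (m + 2)) {j n : ℕ} (hjn : j ≤ n) :
    M (j + 1) * M n ≤ M j * M (n + 1) := by
  have hmono : Monotone fun m => M (m + 1) / M m := monotone_nat_of_le_succ fun m => by
    rw [div_le_div_iff₀ (hM _) (hM _)]
    linarith [hlc m]
  have := hmono hjn
  rw [div_le_div_iff₀ (hM _) (hM _)] at this
  linarith

open Real in
/-- One step of Bang's argument: moving by `e⁻¹ * M n / M (n + 1)` costs a factor `e`. -/
theorem bang_step (hG : ∀ m t, HasDerivAt (G m) (G (m + 1) t) t) (hM : ∀ m, 0 < M m)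
    (hlc : ∀ m, M (m + 1) ^ 2 ≤ M m * M (m + 2)) (hb : ∀ m t, ‖G m t‖ ≤ M m) {n : ℕ} {x y : ℝ}
    (hx : ∀ j ≤ n + 1, ‖G j x‖ ≤ M j * exp (j - (n + 1)))
    (hxy : x ≤ y) (hy : y ≤ x + exp (-1) * (M n / M (n + 1))) :
    ∀ j ≤ n, ‖G j y‖ ≤ M j * exp (j - n) := by
  set c := exp 1 * (M (n + 1) / M n) with hc
  have hc0 : 0 < c := mul_pos (exp_pos _) (div_pos (hM _) (hM _))
  have key (j : ℕ) (hj : j ≤ n + 1) :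
      ∀ z ∈ Set.Icc x y, ‖G j z‖ ≤ M j * exp (j - (n + 1)) * exp (c * (z - x)) := by
    induction hj using Nat.decreasingInduction with
    | self =>
      intro z hz
      refine (hb _ _).trans ?_
      have : (1 : ℝ) ≤ exp (c * (z - x)) := one_le_exp (mul_nonneg hc0.le (by linarith [hz.1]))
      push_cast
      rw [sub_self, exp_zero, mul_one]
      nlinarith [hM (n + 1)]
    | of_succ j hj ih =>
      have hj : j ≤ n := by omega
      refine image_norm_le_of_norm_deriv_right_le_deriv_boundary
        (f' := G (j + 1))
        (B' := fun z => M j * exp (j - (n + 1)) * (exp (c * (z - x)) * c))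
        (fun z _ => (hG j z).continuousAt.continuousWithinAt)
        (fun z _ => (hG j z).hasDerivWithinAt) ?_ (fun z => ?_) fun z hz => ?_
      · simpa using hx j (by omega)
      · have h1 : HasDerivAt (fun z => c * (z - x)) c z := by
          simpa using ((hasDerivAt_id z).sub_const x).const_mul c
        exact h1.exp.const_mul _
      · refine (ih z (Set.Ico_subset_Icc_self hz)).trans ?_
        have h1 : exp (((j + 1 : ℕ) : ℝ) - (n + 1)) = exp (j - (n + 1)) * exp 1 := by
          rw [← exp_add]; push_cast; ring_nf
        have h2 : M (j + 1) ≤ M j * (M (n + 1) / M n) := by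
          rw [← mul_div_assoc, le_div_iff₀ (hM n)]
          exact mul_le_mul_of_logConvex hM hlc hj
        rw [h1, hc]
        calc _ = M (j + 1) * (exp (j - (n + 1)) * exp 1 * exp (c * (z - x))) := by rw [hc]; ring
          _ ≤ (M j * (M (n + 1) / M n)) * (exp (j - (n + 1)) * exp 1 * exp (c * (z - x))) := by
            gcongr
          _ = _ := by rw [hc]; ring
  intro j hj
  refine (key j (by omega) y ⟨hxy, le_rfl⟩).trans ?_
  rw [mul_assoc, ← exp_add]
  have h1 : c * (y - x) ≤ 1 := by
    calc c * (y - x) ≤ c * (exp (-1) * (M n / M (n + 1))) := by gcongr; linarith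
      _ = exp 1 * exp (-1) * (M (n + 1) / M n * (M n / M (n + 1))) := by rw [hc]; ring
      _ = 1 := by
        rw [← exp_add, div_mul_div_cancel₀ (hM n).ne', div_self (hM _).ne']; simp
  have := (hM j).le
  gcongr
  linarith

open Real in
theorem bang_iterate (hG : ∀ m t, HasDerivAt (G m) (G (m + 1) t) t) (hM : ∀ m, 0 < M m)
    (hlc : ∀ m, M (m + 1) ^ 2 ≤ M m * M (m + 2)) (hb : ∀ m t, ‖G m t‖ ≤ M m)
    (h0 : ∀ m, G m 0 = 0) (d n : ℕ) {y : ℝ} (hy0 : 0 ≤ y)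
    (hy : y ≤ exp (-1) * ∑ i ∈ Finset.range d, M (i + n) / M (i + n + 1)) :
    ∀ j ≤ n, ‖G j y‖ ≤ M j * exp (j - n) := by
  induction d generalizing n y with
  | zero =>
    have : y = 0 := le_antisymm (by simpa using hy) hy0
    intro j _
    rw [this, h0, norm_zero]
    exact mul_nonneg (hM j).le (exp_pos _).le
  | succ d ih =>
    set T := exp (-1) * ∑ i ∈ Finset.range d, M (i + (n + 1)) / M (i + (n + 1) + 1) with hT
    have hT0 : 0 ≤ T := mul_nonneg (exp_pos _).le
      (Finset.sum_nonneg fun i _ => (div_pos (hM _) (hM _)).le)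
    have hyT : y ≤ T + exp (-1) * (M n / M (n + 1)) := by
      rw [Finset.sum_range_succ', mul_add] at hy
      simpa [hT, add_assoc, add_comm 1] using hy
    have hx := ih (n + 1) (le_min hy0 hT0) (min_le_right y T)
    refine bang_step hG hM hlc hb (x := min y T) (by exact_mod_cast hx) (min_le_left _ _) ?_
    have := mul_nonneg (exp_pos (-1)).le (div_pos (hM n) (hM (n + 1))).le
    rcases le_total y T with h | h
    · rw [min_eq_left h]; linarith
    · rw [min_eq_right h]; exact hyT

open Real in
theorem denjoy_carleman_of_nonneg (hG : ∀ m t, HasDerivAt (G m) (G (m + 1) t) t)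
    (hM : ∀ m, 0 < M m) (hlc : ∀ m, M (m + 1) ^ 2 ≤ M m * M (m + 2))
    (hb : ∀ m t, ‖G m t‖ ≤ M m) (h0 : ∀ m, G m 0 = 0)
    (hdiv : ¬ Summable fun m => M m / M (m + 1)) {t : ℝ} (ht : 0 ≤ t) : G 0 t = 0 := by
  have hbound (n : ℕ) : ‖G 0 t‖ ≤ M 0 * exp (-n) := by
    have hdiv' := mt (summable_nat_add_iff n).1 hdiv
    rw [not_summable_iff_tendsto_nat_atTop_of_nonneg
      fun i => (div_pos (hM _) (hM _)).le] at hdiv'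
    obtain ⟨d, hd⟩ := (hdiv'.eventually_ge_atTop (exp 1 * t)).exists
    have hd' : t ≤ exp (-1) * ∑ i ∈ Finset.range d, M (i + n) / M (i + n + 1) := by
      calc t = exp (-1) * (exp 1 * t) := by rw [← mul_assoc, ← exp_add]; simp
        _ ≤ _ := by gcongr
    simpa using bang_iterate hG hM hlc hb h0 d n ht hd' 0 n.zero_le
  have hlim : Filter.Tendsto (fun n : ℕ => M 0 * exp (-n)) Filter.atTop (nhds (M 0 * 0)) :=
    (tendsto_exp_neg_atTop_nhds_zero.comp tendsto_natCast_atTop_atTop).const_mul _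
  rw [mul_zero] at hlim
  exact norm_le_zero_iff.1 (ge_of_tendsto' hlim hbound)

/-- The **Denjoy–Carleman theorem** on the line: `G m` is the `m`-th derivative of `G 0`. -/
theorem denjoy_carleman (hG : ∀ m t, HasDerivAt (G m) (G (m + 1) t) t)
    (hM : ∀ m, 0 < M m) (hlc : ∀ m, M (m + 1) ^ 2 ≤ M m * M (m + 2))
    (hb : ∀ m t, ‖G m t‖ ≤ M m) (h0 : ∀ m, G m 0 = 0)
    (hdiv : ¬ Summable fun m => M m / M (m + 1)) (t : ℝ) : G 0 t = 0 := by
  rcases le_total 0 t with ht | ht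
  · exact denjoy_carleman_of_nonneg hG hM hlc hb h0 hdiv ht
  · have h := denjoy_carleman_of_nonneg (G := fun m t => (-1 : ℝ) ^ m • G m (-t)) (M := M)
      (fun m t => ?_) hM hlc (fun m t => ?_) (fun m => by simp [h0]) hdiv (neg_nonneg.2 ht)
    · simpa using h
    · have := ((hG m (-t)).scomp t (hasDerivAt_neg t)).const_smul ((-1 : ℝ) ^ m)
      simpa [pow_succ, smul_smul] using! this
    · simpa [norm_smul] using hb m (-t)

end Bang

section Fourier

open Complex

variable {Ω : Type*} [MeasurableSpace Ω] {μ μ₁ μ₂ : Measure Ω} {X : Ω → ℝ} {w : Ω → ℂ}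

theorem integral_norm_mul_norm_le_sqrt {E F : Type*} [NormedAddCommGroup E]
    [NormedAddCommGroup F] {f : Ω → E} {g : Ω → F} (hf : MemLp f 2 μ) (hg : MemLp g 2 μ) :
    ∫ ω, ‖f ω‖ * ‖g ω‖ ∂μ ≤ √(∫ ω, ‖f ω‖ ^ 2 ∂μ) * √(∫ ω, ‖g ω‖ ^ 2 ∂μ) := by
  have h := integral_mul_norm_le_Lp_mul_Lq (μ := μ) (f := fun ω => ‖f ω‖) (g := fun ω => ‖g ω‖)
    Real.HolderConjugate.two_two (by simpa using hf.norm) (by simpa using hg.norm)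
  simpa [Real.sqrt_eq_rpow] using h

theorem hasDerivAt_integral_pow_mul_cexp (hX : Measurable X) (hw : AEStronglyMeasurable w μ)
    (hint : ∀ m : ℕ, Integrable (fun ω => (X ω : ℂ) ^ m * w ω) μ) (m : ℕ) (t : ℝ) :
    HasDerivAt (fun t : ℝ => ∫ ω, (X ω * I) ^ m * w ω * cexp (t * (X ω * I)) ∂μ)
      (∫ ω, (X ω * I) ^ (m + 1) * w ω * cexp (t * (X ω * I)) ∂μ) t := by
  have hexp (t x : ℝ) : ‖cexp (t * (x * I))‖ = 1 := by
    rw [← mul_assoc, ← ofReal_mul, norm_exp_ofReal_mul_I]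
  have hmeas (m : ℕ) (t : ℝ) : AEStronglyMeasurable
      (fun ω => (X ω * I) ^ m * w ω * cexp (t * (X ω * I))) μ := by
    have h1 : Measurable fun ω => ((X ω : ℂ) * I) ^ m := by fun_prop
    have h2 : Measurable fun ω => cexp (t * (X ω * I)) := by fun_prop
    exact (h1.aestronglyMeasurable.mul hw).mul h2.aestronglyMeasurable
  have hnorm (m : ℕ) (t : ℝ) (ω : Ω) :
      ‖((X ω : ℂ) * I) ^ m * w ω * cexp (t * (X ω * I))‖ = ‖(X ω : ℂ) ^ m * w ω‖ := by
    rw [norm_mul, hexp, mul_one, mul_pow, norm_mul, norm_mul, norm_mul, norm_pow I]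
    simp
  refine (hasDerivAt_integral_of_dominated_loc_of_deriv_le (s := Set.univ) Filter.univ_mem
    (bound := fun ω => ‖(X ω : ℂ) ^ (m + 1) * w ω‖) (.of_forall fun t => hmeas m t) ?_
    (hmeas (m + 1) t) (.of_forall fun ω t _ => (hnorm (m + 1) t ω).le) (hint _).norm
    (.of_forall fun ω t _ => ?_)).2
  · exact (hint m).mono (hmeas m t) (.of_forall fun ω => (hnorm m t ω).le)
  · have h1 : HasDerivAt (fun t : ℝ => (t : ℂ) * (X ω * I)) (X ω * I) t := by
      simpa using (hasDerivAt_id t).ofReal_comp.mul_const ((X ω : ℂ) * I)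
    convert! h1.cexp.const_mul ((X ω * I) ^ m * w ω) using 1
    ring

theorem norm_integral_pow_mul_cexp_le (hX : ∀ m : ℕ, MemLp (fun ω => X ω ^ m) 2 μ)
    (hw : MemLp w 2 μ) (m : ℕ) (t : ℝ) :
    ‖∫ ω, (X ω * I) ^ m * w ω * cexp (t * (X ω * I)) ∂μ‖ ≤
      √(∫ ω, ‖w ω‖ ^ 2 ∂μ) * √(∫ ω, X ω ^ (2 * m) ∂μ) := by
  refine (norm_integral_le_integral_norm _).trans ?_
  have h := integral_norm_mul_norm_le_sqrt (hX m) hw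
  have h1 (ω : Ω) : ‖((X ω : ℂ) * I) ^ m * w ω * cexp (t * (X ω * I))‖ = ‖X ω ^ m‖ * ‖w ω‖ := by
    rw [norm_mul, ← mul_assoc, ← ofReal_mul, norm_exp_ofReal_mul_I, norm_mul, mul_one, mul_pow]
    simp
  have h2 (ω : Ω) : ‖X ω ^ m‖ ^ 2 = X ω ^ (2 * m) := by
    rw [Real.norm_eq_abs, sq_abs, ← pow_mul, mul_comm]
  simp only [h2] at h
  simp only [h1]
  linarith [mul_comm √(∫ ω, ‖w ω‖ ^ 2 ∂μ) √(∫ ω, X ω ^ (2 * m) ∂μ)]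

theorem integral_even_pow_pos_of_carleman (hX : ∀ m : ℕ, MemLp (fun ω => X ω ^ m) 2 μ)
    (hdiv : ¬ Summable fun m : ℕ =>
      (∫ ω, X ω ^ (2 * (m + 1)) ∂μ) ^ (-(1 : ℝ) / (2 * (m + 1)))) (m : ℕ) :
    0 < ∫ ω, X ω ^ (2 * m) ∂μ := by
  have hnn (ω : Ω) : 0 ≤ X ω ^ (2 * m) := (even_two_mul m).pow_nonneg _
  refine (integral_nonneg hnn).lt_of_ne' fun h0 => hdiv ?_
  have hint : Integrable (fun ω => X ω ^ (2 * m)) μ := by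
    simpa [← pow_mul, mul_comm] using (hX m).integrable_sq
  have hae := (integral_eq_zero_iff_of_nonneg hnn hint).1 h0
  have hz (k : ℕ) : ∫ ω, X ω ^ (2 * (k + 1)) ∂μ = 0 := by
    refine integral_eq_zero_of_ae (hae.mono fun ω hω => ?_)
    have : X ω = 0 := eq_zero_of_pow_eq_zero hω
    simp [this]
  refine summable_zero.congr fun k => ?_
  rw [hz, Real.zero_rpow]
  exact div_ne_zero (by norm_num) (by positivity)

/-- If the even moments of `X` satisfy Carleman's condition, then the moments of `X` against the
complex measures `w μ₁` and `w μ₂` determine their Fourier transforms along `X`. -/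
theorem integral_mul_cexp_eq_of_carleman (hX : Measurable X)
    (hX₁ : ∀ m : ℕ, MemLp (fun ω => X ω ^ m) 2 μ₁) (hX₂ : ∀ m : ℕ, MemLp (fun ω => X ω ^ m) 2 μ₂)
    (hw₁ : MemLp w 2 μ₁) (hw₂ : MemLp w 2 μ₂)
    (hmom : ∀ m : ℕ, ∫ ω, X ω ^ m ∂μ₁ = ∫ ω, X ω ^ m ∂μ₂)
    (hmomw : ∀ m : ℕ, ∫ ω, (X ω : ℂ) ^ m * w ω ∂μ₁ = ∫ ω, (X ω : ℂ) ^ m * w ω ∂μ₂)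
    (hdiv : ¬ Summable fun m : ℕ =>
      (∫ ω, X ω ^ (2 * (m + 1)) ∂μ₁) ^ (-(1 : ℝ) / (2 * (m + 1)))) (t : ℝ) :
    ∫ ω, w ω * cexp (t * (X ω * I)) ∂μ₁ = ∫ ω, w ω * cexp (t * (X ω * I)) ∂μ₂ := by
  set S : ℕ → ℝ := fun m => ∫ ω, X ω ^ (2 * m) ∂μ₁ with hS
  have hSpos (m) : 0 < S m := integral_even_pow_pos_of_carleman hX₁ hdiv m
  set C : ℝ := √(∫ ω, ‖w ω‖ ^ 2 ∂μ₁) + √(∫ ω, ‖w ω‖ ^ 2 ∂μ₂) + 1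
  have hC : 0 < C := by positivity
  have hint {μ : Measure Ω} (hXμ : ∀ m : ℕ, MemLp (fun ω => X ω ^ m) 2 μ) (hwμ : MemLp w 2 μ)
      (m : ℕ) : Integrable (fun ω => (X ω : ℂ) ^ m * w ω) μ := by
    have : MemLp (fun ω => ((X ω ^ m : ℝ) : ℂ)) 2 μ := (hXμ m).ofReal
    simpa [Pi.mul_def] using MemLp.integrable_mul this hwμ
  have hlogS (m) : S (m + 1) ≤ √(S m) * √(S (m + 2)) := by
    have h := integral_norm_mul_norm_le_sqrt (hX₁ m) (hX₁ (m + 2))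
    convert h using 1
    · refine integral_congr_ae (.of_forall fun ω => ?_)
      simp only [← norm_mul, ← pow_add]
      rw [show m + (m + 2) = 2 * (m + 1) by ring, Real.norm_of_nonneg]
      exact (even_two_mul _).pow_nonneg _
    · simp only [hS, Real.norm_eq_abs, sq_abs, ← pow_mul, mul_comm 2]
  have hratio : ¬ Summable fun m => √(S m) / √(S (m + 1)) := by
    refine not_summable_ratio_of_carleman (M := fun m => √(S m))
      (fun m => Real.sqrt_pos.2 (hSpos m)) (mt (fun h => h.congr fun m => ?_) hdiv)
    rw [Real.sqrt_eq_rpow, ← Real.rpow_mul (hSpos _).le]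
    congr 1
    field_simp
  have hzero := denjoy_carleman (M := fun m => C * √(S m))
    (G := fun m t => ∫ ω, (X ω * I) ^ m * w ω * cexp (t * (X ω * I)) ∂μ₁ -
      ∫ ω, (X ω * I) ^ m * w ω * cexp (t * (X ω * I)) ∂μ₂)
    (fun m t => (hasDerivAt_integral_pow_mul_cexp hX hw₁.1 (hint hX₁ hw₁) m t).sub
      (hasDerivAt_integral_pow_mul_cexp hX hw₂.1 (hint hX₂ hw₂) m t))
    (fun m => mul_pos hC (Real.sqrt_pos.2 (hSpos m)))
    (fun m => ?_) (fun m t => ?_) (fun m => ?_) (by simpa [mul_div_mul_left _ _ hC.ne']) t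
  · simpa [sub_eq_zero] using hzero
  · rw [mul_pow, Real.sq_sqrt (hSpos _).le]
    calc C ^ 2 * S (m + 1) ≤ C ^ 2 * (√(S m) * √(S (m + 2))) := by gcongr; exact hlogS m
      _ = _ := by ring
  · have h1 := norm_integral_pow_mul_cexp_le hX₁ hw₁ m t
    have h2 := norm_integral_pow_mul_cexp_le hX₂ hw₂ m t
    rw [← hmom] at h2
    refine (norm_sub_le _ _).trans ((add_le_add h1 h2).trans ?_)
    rw [← add_mul]
    gcongr
    simp [C]
  · have h (μ : Measure Ω) : ∫ ω, (X ω * I) ^ m * w ω * cexp ((0 : ℝ) * (X ω * I)) ∂μ =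
        I ^ m * ∫ ω, (X ω : ℂ) ^ m * w ω ∂μ := by
      rw [← integral_const_mul]
      refine integral_congr_ae (.of_forall fun ω => ?_)
      simp [mul_pow]
      ring
    simp only [h, hmomw, sub_self]

end Fourier

section Euclidean

variable {n : ℕ} {μ : Measure (EuclideanSpace ℝ (Fin n))}

theorem prod_pow_single (x : EuclideanSpace ℝ (Fin n)) (j : Fin n) (m : ℕ) :
    ∏ i, x i ^ (Pi.single j m : Fin n → ℕ) i = x j ^ m := by
  rw [Finset.prod_eq_single j (fun i _ h => by simp [h]) (by simp), Pi.single_eq_same]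

theorem HasAllMoments.memLp_monomial (h : HasAllMoments μ) (α : Fin n → ℕ) :
    MemLp (fun x : EuclideanSpace ℝ (Fin n) => ∏ j, x j ^ α j) 2 μ := by
  have hmeas : AEStronglyMeasurable (fun x : EuclideanSpace ℝ (Fin n) => ∏ j, x j ^ α j) μ :=
    (by fun_prop : Continuous _).aestronglyMeasurable
  rw [memLp_two_iff_integrable_sq_norm hmeas]
  have hd := h ((∑ j, α j) * 2 : ℕ) (Nat.cast_nonneg _)
  simp only [Real.rpow_natCast] at hd
  refine hd.mono (hmeas.norm.pow 2) (.of_forall fun x => ?_)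
  rw [norm_pow, norm_norm, norm_pow, norm_norm, pow_mul, norm_prod, ← Finset.prod_pow_eq_pow_sum]
  gcongr with j
  rw [norm_pow]
  gcongr
  exact PiLp.norm_apply_le x j

theorem HasAllMoments.memLp_coord_pow (h : HasAllMoments μ) (j : Fin n) (m : ℕ) :
    MemLp (fun x : EuclideanSpace ℝ (Fin n) => x j ^ m) 2 μ := by
  simpa only [prod_pow_single] using h.memLp_monomial (Pi.single j m)

end Euclidean

/-- De Jeu's multivariable Carleman theorem: two positive measures with all moments finite
and equal moments `s(α)`, satisfying the Carleman condition
`∑_m s(2m e_j)^{-1/(2m)} = ∞` for each `j`, coincide. -/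
theorem carleman_multivariable {n : ℕ}
    (μ₁ μ₂ : Measure (EuclideanSpace ℝ (Fin n)))
    (h₁ : HasAllMoments μ₁) (h₂ : HasAllMoments μ₂)
    (hmom : ∀ α : Fin n → ℕ,
      ∫ x, (∏ j, (x j) ^ (α j)) ∂μ₁ = ∫ x, (∏ j, (x j) ^ (α j)) ∂μ₂)
    (hdiv : ∀ j : Fin n, ¬ Summable (fun m : ℕ =>
      (∫ x, (x j) ^ (2 * (m + 1)) ∂μ₁) ^ (-(1 : ℝ) / (2 * (m + 1))))) :
    μ₁ = μ₂ := by
  have isFinite {μ : Measure (EuclideanSpace ℝ (Fin n))} (h : HasAllMoments μ) :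
      IsFiniteMeasure μ := by
    have h0 := h 0 le_rfl
    simp only [Real.rpow_zero] at h0
    exact (integrable_const_iff_isFiniteMeasure one_ne_zero).1 h0
  have := isFinite h₁
  have := isFinite h₂
  set w : (Fin n → ℝ) → Finset (Fin n) → (Fin n → ℕ) → EuclideanSpace ℝ (Fin n) → ℂ :=
    fun t s α x => ((∏ j, x j ^ α j : ℝ) : ℂ) * Complex.exp (((∑ j ∈ s, t j * x j : ℝ) : ℂ) *
      Complex.I) with hw
  have memLp_w {μ : Measure (EuclideanSpace ℝ (Fin n))} (h : HasAllMoments μ) (t s α) :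
      MemLp (w t s α) 2 μ := by
    refine (h.memLp_monomial α).of_le (by fun_prop : Continuous _).aestronglyMeasurable
      (.of_forall fun x => ?_)
    rw [hw, norm_mul, Complex.norm_exp_ofReal_mul_I, mul_one, Complex.norm_real]
  have key (t : Fin n → ℝ) (s : Finset (Fin n)) :
      ∀ α : Fin n → ℕ, ∫ x, w t s α x ∂μ₁ = ∫ x, w t s α x ∂μ₂ := by
    induction s using Finset.induction_on with
    | empty =>
      intro α
      simp only [hw, Finset.sum_empty, Complex.ofReal_zero, zero_mul, Complex.exp_zero, mul_one,
        integral_complex_ofReal, hmom]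
    | insert k s hk ih =>
      intro α
      have hcoord (m : ℕ) : ∫ x, x k ^ m ∂μ₁ = ∫ x, x k ^ m ∂μ₂ := by
        simpa only [prod_pow_single] using hmom (Pi.single k m)
      have hstep := integral_mul_cexp_eq_of_carleman (μ₁ := μ₁) (μ₂ := μ₂)
        (X := fun x : EuclideanSpace ℝ (Fin n) => x k) (w := w t s α)
        (by fun_prop) (h₁.memLp_coord_pow k) (h₂.memLp_coord_pow k) (memLp_w h₁ t s α)
        (memLp_w h₂ t s α) hcoord (fun m => ?_) (hdiv k) (t k)
      · have hsplit (x : EuclideanSpace ℝ (Fin n)) :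
            w t (insert k s) α x = w t s α x * Complex.exp (t k * (x k * Complex.I)) := by
          simp only [hw]
          rw [mul_assoc, ← Complex.exp_add, Finset.sum_insert hk]
          push_cast
          ring_nf
        simp only [hsplit, hstep]
      · have hshift (x : EuclideanSpace ℝ (Fin n)) :
            (x k : ℂ) ^ m * w t s α x = w t s (Pi.single k m + α) x := by
          simp only [hw, Pi.add_apply, pow_add, Finset.prod_mul_distrib, prod_pow_single]
          push_cast
          ring
        simp only [hshift, ih]
  refine Measure.ext_of_charFun (funext fun t => ?_)
  have h := key t Finset.univ 0
  simpa [hw, charFun_apply, PiLp.inner_apply] using h
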